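/- Let f : X → Y be a morphism of schemes of finite type over an algebraically closed field k, with X nonempty, Y irreducible, and suppose dim_z(X) − dim_{f(z)}(Y) = dim_z(f⁻¹(f(z))) for all z ∈ X. Then f is dominant, i.e., the closure of f(X) equals Y. -/

import Mathlib

open AlgebraicGeometry CategoryTheory Topology

/-- The local dimension of a topological space at a point: the supremum of the
Krull dimensions of the irreducible components containing the point. -/
noncomputable def localDim (X : Type*) [TopologicalSpace X] (z : X) : WithBot ℕ∞ :=
  ⨆ C ∈ {C ∈ irreducibleComponents X | z ∈ C}, topologicalKrullDim C

universe u v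

/-- An integral extension of rings has the same Krull dimension. -/
theorem ringKrullDim_eq_of_isIntegral (R S : Type*) [CommRing R] [CommRing S] [Algebra R S]
    [Algebra.IsIntegral R S] [FaithfulSMul R S] : ringKrullDim R = ringKrullDim S := by
  apply le_antisymm
  · refine iSup_le fun l ↦ ?_
    obtain ⟨P, hP⟩ := Algebra.IsIntegral.comap_surjective R S l.head
    have : P.asIdeal.LiesOver l.head.asIdeal := ⟨by rw [← hP]; rfl⟩
    obtain ⟨L, hL, -⟩ := Ideal.exists_ltSeries_of_hasGoingUp l P.asIdeal
    rw [← hL]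
    exact Order.LTSeries.length_le_krullDim L
  · exact Order.krullDim_le_of_strictMono (PrimeSpectrum.comap (algebraMap R S))
      fun p q h ↦ Ideal.IsIntegral.comap_lt_comap (R := R) h

/-- The Krull dimension of a finitely generated domain over a field is its transcendence
degree. -/
theorem exists_ringKrullDim_eq_and_trdeg_eq (K : Type u) (A : Type v) [Field K]
    [CommRing A] [IsDomain A] [Algebra K A] [Algebra.FiniteType K A] :
    ∃ n : ℕ, ringKrullDim A = n ∧ Algebra.trdeg K A = n := by
  obtain ⟨n, g, hg, hfin⟩ := exists_integral_inj_algHom_of_fg K A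
  algebraize [g.toRingHom]
  have : FaithfulSMul (MvPolynomial (Fin n) K) A :=
    (faithfulSMul_iff_algebraMap_injective _ _).mpr hg
  have : Algebra.IsIntegral (MvPolynomial (Fin n) K) A := ⟨hfin⟩
  have : IsScalarTower K (MvPolynomial (Fin n) K) A := .of_algHom g
  refine ⟨n, ?_, ?_⟩
  · rw [← ringKrullDim_eq_of_isIntegral (MvPolynomial (Fin n) K) A]
    simp
  · have := lift_trdeg_add_eq K (MvPolynomial (Fin n) K) A
    rw [trdeg_eq_zero (R := MvPolynomial (Fin n) K), Cardinal.lift_zero, add_zero] at this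
    apply Cardinal.lift_injective
    rw [← this]
    simp

/-- For an extension of finitely generated domains over a field, the dimension of the larger one
is the sum of the dimensions of the smaller one and of the generic fiber. -/
theorem exists_ringKrullDim_add (K : Type*) (B A : Type u) [Field K] [CommRing B] [CommRing A]
    [IsDomain B] [IsDomain A] [Algebra K B] [Algebra K A] [Algebra B A] [IsScalarTower K B A]
    [Algebra.FiniteType K B] [Algebra.FiniteType K A] [FaithfulSMul B A] :
    ∃ m n : ℕ, ringKrullDim B = m ∧ ringKrullDim A = ↑(n + m) ∧
      ringKrullDim (Localization (Algebra.algebraMapSubmonoid A (nonZeroDivisors B))) = n := by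
  let S := Algebra.algebraMapSubmonoid A (nonZeroDivisors B)
  have hS : S ≤ nonZeroDivisors A :=
    map_le_nonZeroDivisors_of_injective _ (FaithfulSMul.algebraMap_injective B A) le_rfl
  let L := FractionRing B
  let T := Localization S
  have : IsDomain T := IsLocalization.isDomain_localization hS
  let _ : Algebra L T := localizationAlgebra (nonZeroDivisors B) A
  have : IsScalarTower B L T := inferInstance
  have : Algebra.FiniteType B A := .of_restrictScalars_finiteType K B A
  have : Algebra.FiniteType L T := by
    have : IsLocalization ((nonZeroDivisors B).map (algebraMap B A)) T :=
      inferInstanceAs (IsLocalization S T)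
    exact RingHom.finiteType_localizationPreserves (algebraMap B A) (nonZeroDivisors B) L T
      (RingHom.finiteType_algebraMap.mpr ‹_›)
  have : FaithfulSMul A T :=
    (faithfulSMul_iff_algebraMap_injective _ _).mpr (IsLocalization.injective T hS)
  have : FaithfulSMul B T := .trans B A T
  have : FaithfulSMul L T :=
    (faithfulSMul_iff_algebraMap_injective _ _).mpr (algebraMap L T).injective
  obtain ⟨m, hm, hm'⟩ := exists_ringKrullDim_eq_and_trdeg_eq K B
  obtain ⟨r, hr, hr'⟩ := exists_ringKrullDim_eq_and_trdeg_eq K A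
  obtain ⟨n, hn, hn'⟩ := exists_ringKrullDim_eq_and_trdeg_eq L T
  refine ⟨m, n, hm, ?_, hn⟩
  have h1 := lift_trdeg_add_eq K B A
  have h2 := trdeg_add_eq B L (A := T)
  have h3 := trdeg_add_eq B A (A := T)
  have : Algebra.IsAlgebraic B L := IsLocalization.isAlgebraic L (nonZeroDivisors B)
  have : Algebra.IsAlgebraic A T := IsLocalization.isAlgebraic T S
  rw [trdeg_eq_zero, zero_add] at h2
  rw [trdeg_eq_zero (R := A), add_zero] at h3
  simp only [hn', hm', hr', h3, ← h2] at h1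
  have h4 : (r : Cardinal) = n + m := by
    simpa [add_comm] using h1.symm
  rw [hr, show r = n + m from mod_cast h4]

/-- Krull dimension is monotone for subspaces, here given by inducing maps to a common space. -/
theorem topologicalKrullDim_le_of_range_subset {S T X : Type*} [TopologicalSpace S]
    [TopologicalSpace T] [TopologicalSpace X] {g : S → X} {e : T → X} (hg : IsInducing g)
    (he : IsInducing e) (h : Set.range g ⊆ Set.range e) :
    topologicalKrullDim S ≤ topologicalKrullDim T := by
  choose j hj using fun s ↦ h ⟨s, rfl⟩
  obtain rfl : e ∘ j = g := funext hj
  exact (he.of_comp_iff.mp hg).topologicalKrullDim_le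

open TopologicalSpace in
/-- The Krull dimension of a space is bounded by a bound for those of an open cover. -/
theorem topologicalKrullDim_le_of_forall_exists_isOpen {T : Type*} [TopologicalSpace T]
    {n : WithBot ℕ∞}
    (h : ∀ x : T, ∃ U : Set T, IsOpen U ∧ x ∈ U ∧ topologicalKrullDim U ≤ n) :
    topologicalKrullDim T ≤ n := by
  refine iSup_le fun p ↦ ?_
  obtain ⟨x, hx⟩ := p.head.isIrreducible.nonempty
  obtain ⟨U, hU, hxU, hn⟩ := h x
  refine le_trans ?_ hn
  let E := IrreducibleCloseds.orderIsoOfIsOpenEmbedding _ hU.isOpenEmbedding_subtypeVal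
  let q : LTSeries {V : IrreducibleCloseds T | ((↑) ⁻¹' (V : Set T) : Set U).Nonempty} :=
    { length := p.length
      toFun := fun i ↦ ⟨p i, ⟨x, hxU⟩, LTSeries.head_le p i hx⟩
      step := fun i ↦ p.step i }
  exact Order.LTSeries.length_le_krullDim (q.map E.symm E.symm.strictMono)

open TopologicalSpace in
/-- A proper closed subset of an irreducible space has smaller Krull dimension. -/
theorem topologicalKrullDim_add_one_le {T : Type*} [TopologicalSpace T] [IrreducibleSpace T]
    {Z : Set T} (hZ : IsClosed Z) (hne : Z ≠ Set.univ) (hZ' : Z.Nonempty) :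
    topologicalKrullDim Z + 1 ≤ topologicalKrullDim T := by
  obtain ⟨z, hz⟩ := hZ'
  have : Nonempty (IrreducibleCloseds Z) :=
    ⟨⟨closure {⟨z, hz⟩}, isIrreducible_singleton.closure, isClosed_closure⟩⟩
  rw [topologicalKrullDim, ← Order.krullDim_WithTop]
  let u : IrreducibleCloseds T := ⟨Set.univ, IrreducibleSpace.isIrreducible_univ T, isClosed_univ⟩
  let m := IrreducibleCloseds.map (Subtype.val : Z → T) continuous_subtype_val
  have hm : StrictMono m := IrreducibleCloseds.map_strictMono_of_isInducing .subtypeVal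
  have hmZ (V) : m V < u := by
    have : (m V : Set T) ⊆ Z := closure_minimal (by simp) hZ
    refine SetLike.coe_ssubset_coe.mp ?_
    exact (this.trans_ssubset (Set.ssubset_univ_iff.mpr hne))
  refine Order.krullDim_le_of_strictMono (WithTop.recTopCoe u m) ?_
  intro a b hab
  induction a with
  | top => simp at hab
  | coe a =>
    induction b with
    | top => exact hmZ a
    | coe b => exact hm (WithTop.coe_lt_coe.mp hab)

theorem topologicalKrullDim_closure_le_localDim (X : Type*) [TopologicalSpace X] (z : X) :
    topologicalKrullDim (closure {z} : Set X) ≤ localDim X z := by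
  have h1 : topologicalKrullDim (closure {z} : Set X) ≤
      topologicalKrullDim (irreducibleComponent z) :=
    topologicalKrullDim_le_of_range_subset .subtypeVal .subtypeVal (by
      simpa using closure_minimal (by simpa using mem_irreducibleComponent)
        isClosed_irreducibleComponent)
  exact h1.trans (le_iSup₂_of_le (irreducibleComponent z)
    ⟨irreducibleComponent_mem_irreducibleComponents z, mem_irreducibleComponent⟩ le_rfl)

theorem localDim_eq_of_isGenericPoint {X : Type*} [TopologicalSpace X] {z : X} {C : Set X}
    (hC : C ∈ irreducibleComponents X) (hz : IsGenericPoint z C) :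
    localDim X z = topologicalKrullDim C := by
  refine le_antisymm (iSup₂_le fun D hD ↦ ?_) (le_iSup₂_of_le C ⟨hC, hz.mem⟩ le_rfl)
  obtain rfl : C = D := by
    have h : C ⊆ D :=
      (hz.mem_closed_set_iff (isClosed_of_mem_irreducibleComponents _ hD.1)).mp hD.2
    exact h.antisymm (hC.2 hD.1.1 h)
  exact le_rfl

theorem localDim_eq_of_irreducibleSpace (X : Type*) [TopologicalSpace X] [IrreducibleSpace X]
    (z : X) : localDim X z = topologicalKrullDim X := by
  refine le_antisymm (iSup₂_le fun D _ ↦ topologicalKrullDim_subspace_le X D)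
    (le_iSup₂_of_le Set.univ ⟨by simp [irreducibleComponents_eq_singleton], trivial⟩ ?_)
  exact (Homeomorph.Set.univ X).isHomeomorph.topologicalKrullDim_eq.ge

open PrimeSpectrum in
/-- For rings of finite type over a field, a prime `P` of `A` lying over `Q` in `B` satisfies
`dim A / P ≤ dim B / Q + d`, all finite, where `d` is the dimension of the closure of `P` in its
fibre. -/
theorem PrimeSpectrum.exists_topologicalKrullDim_closure_le {K B A : Type u} [Field K]
    [CommRing B] [CommRing A] (i : K →+* B) (φ : B →+* A) (hi : i.FiniteType)
    (hφ : (φ.comp i).FiniteType) (P : PrimeSpectrum A) :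
    ∃ m n : ℕ, m ≤ topologicalKrullDim (closure {comap φ P}) ∧
      topologicalKrullDim (closure {P}) ≤ ↑(n + m) ∧
      n ≤ topologicalKrullDim ↥(closure {P} ∩ comap φ ⁻¹' {comap φ P}) := by
  algebraize [i, φ, φ.comp i]
  let Q := comap φ P
  let B' := B ⧸ Q.asIdeal
  let A' := A ⧸ P.asIdeal
  let _ : Algebra B' A' := (Ideal.quotientMap P.asIdeal φ le_rfl).toAlgebra
  have : FaithfulSMul B' A' := (faithfulSMul_iff_algebraMap_injective _ _).mpr
    (Ideal.quotientMap_injective' le_rfl)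
  have : IsScalarTower K B' A' := .of_algebraMap_eq fun x ↦ rfl
  obtain ⟨m, n, hm, hmn, hn⟩ := exists_ringKrullDim_add K B' A'
  let T := Localization (Algebra.algebraMapSubmonoid A' (nonZeroDivisors B'))
  have hB : IsInducing (comap (Ideal.Quotient.mk Q.asIdeal)) :=
    (isClosedEmbedding_comap_of_surjective _ _ Ideal.Quotient.mk_surjective).isInducing
  have hA : IsInducing (comap (Ideal.Quotient.mk P.asIdeal)) :=
    (isClosedEmbedding_comap_of_surjective _ _ Ideal.Quotient.mk_surjective).isInducing
  have hT : IsInducing (comap (algebraMap A' T)) :=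
    (localization_comap_isEmbedding T
      (Algebra.algebraMapSubmonoid A' (nonZeroDivisors B'))).isInducing
  have hAr : Set.range (comap (Ideal.Quotient.mk P.asIdeal)) = closure {P} := by
    rw [range_comap_of_surjective _ _ Ideal.Quotient.mk_surjective, Ideal.mk_ker,
      closure_singleton]
  have hBr : Set.range (comap (Ideal.Quotient.mk Q.asIdeal)) = closure {Q} := by
    rw [range_comap_of_surjective _ _ Ideal.Quotient.mk_surjective, Ideal.mk_ker,
      closure_singleton]
  refine ⟨m, n, ?_, ?_, ?_⟩
  · rw [← hm, ← topologicalKrullDim_eq_ringKrullDim]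
    exact topologicalKrullDim_le_of_range_subset hB .subtypeVal (by simpa using! hBr.le)
  · rw [← hmn, ← topologicalKrullDim_eq_ringKrullDim]
    exact topologicalKrullDim_le_of_range_subset .subtypeVal hA (by simpa using! hAr.ge)
  · rw [← hn, ← topologicalKrullDim_eq_ringKrullDim]
    refine topologicalKrullDim_le_of_range_subset (hA.comp hT) .subtypeVal ?_
    rintro _ ⟨t, rfl⟩
    rw [Subtype.range_coe]
    refine ⟨hAr ▸ ⟨_, rfl⟩, ?_⟩
    have ht : Disjoint (Algebra.algebraMapSubmonoid A' (nonZeroDivisors B') : Set A')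
        (comap (algebraMap A' T) t).asIdeal :=
      (localization_comap_range T (Algebra.algebraMapSubmonoid A' (nonZeroDivisors B'))).le ⟨t, rfl⟩
    refine PrimeSpectrum.ext (le_antisymm (fun b hb ↦ ?_) (fun b hb ↦ ?_))
    · by_contra hbQ
      refine Set.disjoint_left.mp ht ⟨Ideal.Quotient.mk _ b, ?_, rfl⟩ hb
      exact mem_nonZeroDivisors_of_ne_zero (mt Ideal.Quotient.eq_zero_iff_mem.mp hbQ)
    · have : Ideal.Quotient.mk P.asIdeal (φ b) = 0 := Ideal.Quotient.eq_zero_iff_mem.mpr hb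
      change algebraMap A' T (Ideal.Quotient.mk P.asIdeal (φ b)) ∈ t.asIdeal
      rw [this, map_zero]
      exact zero_mem _

/-- For a morphism `f` of schemes locally of finite type over a field, every specialization of
`η` has an open neighbourhood `W` in which the closure of `η` has dimension at most the sum of the
dimension of the closure of `f η` and of the dimension of the closure of `η` in its fibre. -/
theorem exists_isOpen_topologicalKrullDim_closure_inter_le {K : Type u} [Field K]
    {X Y : Scheme.{u}} (f : X ⟶ Y) (sY : Y ⟶ Spec (CommRingCat.of K)) [LocallyOfFiniteType sY]
    [LocallyOfFiniteType (f ≫ sY)] {η x : X} (hx : η ⤳ x) :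
    ∃ (W : Set X) (m n : ℕ), IsOpen W ∧ x ∈ W ∧ m ≤ topologicalKrullDim (closure {f η}) ∧
      topologicalKrullDim ↥(closure {η} ∩ W) ≤ ↑(n + m) ∧
      n ≤ topologicalKrullDim ↥(closure {η} ∩ f ⁻¹' {f η}) := by
  obtain ⟨V, hV, hxV, -⟩ :=
    exists_isAffineOpen_mem_and_subset (TopologicalSpace.Opens.mem_top (f x))
  obtain ⟨W, hW, hxW, hWV⟩ := exists_isAffineOpen_mem_and_subset (x := x) (U := f ⁻¹ᵁ V) hxV
  have e : W ≤ f ⁻¹ᵁ V := hWV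
  have hηW : η ∈ W := hx.mem_open W.2 hxW
  obtain ⟨P, rfl⟩ : η ∈ Set.range hW.fromSpec := by rwa [hW.range_fromSpec]
  let i₀ := (Scheme.ΓSpecIso (.of K)).inv
  have hi₀ : Function.Surjective i₀.hom :=
    (ConcreteCategory.bijective_of_isIso i₀).surjective
  have hsY : V ≤ sY ⁻¹ᵁ ⊤ := le_top
  have hsX : W ≤ (f ≫ sY) ⁻¹ᵁ ⊤ := le_top
  have hcomp : sY.appLE ⊤ V hsY ≫ f.appLE V W e = (f ≫ sY).appLE ⊤ W hsX :=
    Scheme.Hom.appLE_comp_appLE ..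
  obtain ⟨m, n, hm, hmn, hn⟩ := PrimeSpectrum.exists_topologicalKrullDim_closure_le
    ((sY.appLE ⊤ V hsY).hom.comp i₀.hom) (f.appLE V W e).hom
    ((sY.finiteType_appLE (isAffineOpen_top _) hV hsY).comp (.of_surjective _ hi₀))
    (by
      rw [← RingHom.comp_assoc, ← CommRingCat.hom_comp, hcomp]
      exact ((f ≫ sY).finiteType_appLE (isAffineOpen_top _) hW hsX).comp (.of_surjective _ hi₀)) P
  have hsq (Q : PrimeSpectrum Γ(X, W)) :
      hV.fromSpec (PrimeSpectrum.comap (f.appLE V W e).hom Q) = f (hW.fromSpec Q) :=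
    congrArg (fun g : Spec Γ(X, W) ⟶ Y ↦ g Q) (IsAffineOpen.SpecMap_appLE_fromSpec f hV hW e)
  have hWe : IsInducing hW.fromSpec := hW.fromSpec.isOpenEmbedding.isInducing
  have hVe : IsInducing hV.fromSpec := hV.fromSpec.isOpenEmbedding.isInducing
  have hcl {Q} : hW.fromSpec Q ∈ closure {hW.fromSpec P} ↔ Q ∈ closure {P} := by
    simp_rw [← specializes_iff_mem_closure, hWe.specializes_iff]
  refine ⟨W, m, n, W.2, hxW, hm.trans ?_, le_trans ?_ hmn, hn.trans ?_⟩
  · refine topologicalKrullDim_le_of_range_subset (hVe.comp .subtypeVal) .subtypeVal ?_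
    rintro _ ⟨⟨Q, hQ⟩, rfl⟩
    rw [← specializes_iff_mem_closure] at hQ
    rw [Subtype.range_coe, ← hsq P, ← specializes_iff_mem_closure]
    exact hVe.specializes_iff.2 hQ
  · refine topologicalKrullDim_le_of_range_subset .subtypeVal (hWe.comp .subtypeVal) ?_
    rintro _ ⟨⟨y, hy, hyW⟩, rfl⟩
    obtain ⟨Q, rfl⟩ : y ∈ Set.range hW.fromSpec := by rwa [hW.range_fromSpec]
    exact ⟨⟨Q, hcl.1 hy⟩, rfl⟩
  · refine topologicalKrullDim_le_of_range_subset (hWe.comp .subtypeVal) .subtypeVal ?_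
    rintro _ ⟨⟨Q, hQ, hQ'⟩, rfl⟩
    rw [Subtype.range_coe]
    exact ⟨hcl.2 hQ, (hsq Q).symm.trans ((congrArg hV.fromSpec hQ').trans (hsq P))⟩

theorem WithBot.not_le_add_of_add_one_le {a b c d : WithBot ℕ∞} {N m n : ℕ}
    (ha : n ≤ a) (hb : m ≤ b) (hd : d ≤ N) (hac : d = a + c) (hbc : b + 1 ≤ c) : ¬ d ≤ a + b := by
  subst hac
  have key {x : WithBot ℕ∞} (h0 : 0 ≤ x) (hN : x ≤ N) : ∃ n : ℕ, x = n := by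
    lift x to ℕ∞ using (fun h ↦ by simp [h] at h0)
    lift x to ℕ using (fun h ↦ by
      subst h
      exact ENat.natCast_ne_top N (top_le_iff.1 (WithBot.coe_le_coe.1 hN)))
    exact ⟨x, rfl⟩
  have ha0 : 0 ≤ a := le_trans (by simp) ha
  have hb0 : 0 ≤ b := le_trans (by simp) hb
  have hbc' : b ≤ c := le_trans (le_add_of_nonneg_right zero_le_one) hbc
  have hc0 : 0 ≤ c := hb0.trans hbc'
  have hcN : c ≤ N := (le_add_of_nonneg_left ha0).trans hd
  obtain ⟨a, rfl⟩ := key ha0 ((le_add_of_nonneg_right hc0).trans hd)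
  obtain ⟨b, rfl⟩ := key hb0 (hbc'.trans hcN)
  obtain ⟨c, rfl⟩ := key hc0 hcN
  norm_cast at hbc ⊢
  lia

/-- If `f : X ⟶ Y` is a morphism of schemes of finite type over an algebraically closed
field with `X` nonempty, `Y` irreducible, and `dim_z X − dim_{f z} Y = dim_z f⁻¹(f z)`
for all `z ∈ X` (written additively), then `f` is dominant. -/
theorem statement3 {k : Type} [Field k] [IsAlgClosed k]
    (X Y : Scheme) (f : X ⟶ Y)
    (sX : X ⟶ Spec (CommRingCat.of k)) (sY : Y ⟶ Spec (CommRingCat.of k))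
    [LocallyOfFiniteType sX] [LocallyOfFiniteType sY]
    [CompactSpace X] [CompactSpace Y]
    (hcomm : f ≫ sY = sX)
    [Nonempty X] [IrreducibleSpace Y]
    (heq : ∀ z : X,
      localDim X z =
        localDim (f.base ⁻¹' {f.base z} : Set X) ⟨z, rfl⟩ + localDim Y (f.base z)) :
    closure (Set.range f.base) = Set.univ := by
  subst hcomm
  obtain ⟨C, hC⟩ : (irreducibleComponents X).Nonempty :=
    ⟨_, irreducibleComponent_mem_irreducibleComponents (Classical.arbitrary X)⟩
  obtain ⟨η, hη⟩ := QuasiSober.sober hC.1 (isClosed_of_mem_irreducibleComponents C hC)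
  have hη' : closure {η} = C := hη
  suffices h : closure {f η} = Set.univ from
    Set.univ_subset_iff.1 (h ▸ closure_mono (Set.singleton_subset_iff.2 ⟨η, rfl⟩))
  by_contra hne
  have hdim := heq η
  rw [localDim_eq_of_isGenericPoint hC hη, localDim_eq_of_irreducibleSpace Y] at hdim
  have hF : topologicalKrullDim ↥(closure {η} ∩ f ⁻¹' {f η}) ≤
      localDim (f.base ⁻¹' {f.base η} : Set X) ⟨η, rfl⟩ := by
    refine le_trans ?_ (topologicalKrullDim_closure_le_localDim _ _)
    refine topologicalKrullDim_le_of_range_subset .subtypeVal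
      (IsInducing.subtypeVal.comp .subtypeVal) ?_
    rintro _ ⟨⟨y, hy, hy'⟩, rfl⟩
    refine ⟨⟨⟨y, hy'⟩, ?_⟩, rfl⟩
    rw [← specializes_iff_mem_closure] at hy ⊢
    exact IsInducing.subtypeVal.specializes_iff.1 hy
  have hZ := topologicalKrullDim_add_one_le isClosed_closure hne (by simp)
  choose! W m n hWo hxW hm hmn hn using fun x (hx : η ⤳ x) ↦
    exists_isOpen_topologicalKrullDim_closure_inter_le f sY hx
  have hWC (N : WithBot ℕ∞) (x : X) (h : topologicalKrullDim ↥(closure {η} ∩ W x) ≤ N) :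
      topologicalKrullDim ↥((↑) ⁻¹' W x : Set C) ≤ N := by
    refine le_trans (topologicalKrullDim_le_of_range_subset
      (IsInducing.subtypeVal.comp .subtypeVal) .subtypeVal ?_) h
    rintro _ ⟨⟨⟨y, hy⟩, hy'⟩, rfl⟩
    rw [Subtype.range_coe, hη']
    exact ⟨hy, hy'⟩
  have hspec {x : X} (hx : x ∈ C) : η ⤳ x := by rwa [specializes_iff_mem_closure, hη']
  have hle : topologicalKrullDim C ≤
      localDim (f.base ⁻¹' {f.base η} : Set X) ⟨η, rfl⟩ +
        topologicalKrullDim (closure {f η}) := by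
    refine topologicalKrullDim_le_of_forall_exists_isOpen fun x ↦
      ⟨_, (hWo x (hspec x.2)).preimage continuous_subtype_val, hxW x (hspec x.2), hWC _ _ ?_⟩
    refine (hmn x (hspec x.2)).trans ?_
    rw [Nat.cast_add]
    exact add_le_add ((hn x (hspec x.2)).trans hF) (hm x (hspec x.2))
  obtain ⟨N, hN⟩ : ∃ N : ℕ, topologicalKrullDim C ≤ N := by
    obtain ⟨t, htC, ht⟩ := (isClosed_of_mem_irreducibleComponents C hC).isCompact.elim_nhds_subcover
      W fun x hx ↦ (hWo x (hspec hx)).mem_nhds (hxW x (hspec hx))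
    refine ⟨t.sup (n + m), topologicalKrullDim_le_of_forall_exists_isOpen fun x ↦ ?_⟩
    obtain ⟨y, hy, hxy⟩ := Set.mem_iUnion₂.1 (ht x.2)
    have hyC := hspec (htC y hy)
    refine ⟨_, (hWo y hyC).preimage continuous_subtype_val, hxy,
      hWC _ _ ((hmn y hyC).trans ?_)⟩
    exact_mod_cast Finset.le_sup (f := n + m) hy
  have hF0 := (hn η specializes_rfl).trans hF
  have hZ0 := hm η specializes_rfl
  exact WithBot.not_le_add_of_add_one_le hF0 hZ0 hN hdim hZ hle
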